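/- arXiv:1910.05739 — 6 statements merged into one kernel-verified Lean document; each statement's English description precedes it below -/
import Mathlib

section
/- Suppose (φⁿ⁺¹,ψⁿ⁺¹,sⁿ⁺¹) is obtained from (φⁿ,ψⁿ,sⁿ) by one step of the fully discrete SAV scheme for the L² (Allen–Cahn) gradient flow. Then the modified energy satisfies the exact per-step dissipation identity Ẽ(ψⁿ⁺¹,sⁿ⁺¹) − Ẽ(ψⁿ,sⁿ) = −( (1/Δt)‖φⁿ⁺¹−φⁿ‖² + (ξ²/2)‖ψⁿ⁺¹−ψⁿ‖² + (sⁿ⁺¹−sⁿ)² ). -/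
open scoped RealInnerProductSpace

/-- One step of the fully discrete SAV scheme for the L² (Allen–Cahn) gradient flow
satisfies the exact per-step modified-energy dissipation identity. -/
theorem sav_AC_energy_identity
    {V : Type*} [NormedAddCommGroup V] [InnerProductSpace ℝ V]
    (B : V →ₗ[ℝ] V →ₗ[ℝ] ℝ) (hBsymm : ∀ v w : V, B v w = B w v)
    (ξ : ℝ) (Δt : ℝ) (hΔt : 0 < Δt) (u : V)
    (φn φn1 ψn ψn1 : V) (sn sn1 : ℝ)
    (h1 : ∀ v : V, ⟪φn1 - φn, v⟫ =
      -(Δt * (ξ ^ 2 * ⟪ψn1, v⟫ - ξ ^ 2 * B ψn1 v + sn1 * ⟪u, v⟫)))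
    (h2 : ∀ v : V, ⟪ψn1, v⟫ = ⟪φn1, v⟫ - B φn1 v)
    (h2' : ∀ v : V, ⟪ψn, v⟫ = ⟪φn, v⟫ - B φn v)
    (h3 : sn1 - sn = (1 / 2) * ⟪u, φn1 - φn⟫) :
    (ξ ^ 2 / 2 * ‖ψn1‖ ^ 2 + sn1 ^ 2) - (ξ ^ 2 / 2 * ‖ψn‖ ^ 2 + sn ^ 2) =
      -((1 / Δt) * ‖φn1 - φn‖ ^ 2 + ξ ^ 2 / 2 * ‖ψn1 - ψn‖ ^ 2 + (sn1 - sn) ^ 2) := by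
  have hd := h1 (φn1 - φn)
  have hψ : ⟪ψn1, φn1 - φn⟫ - B ψn1 (φn1 - φn) = ‖ψn1‖ ^ 2 - ⟪ψn1, ψn⟫ := by
    have e1 := h2 ψn1
    have e2 := h2' ψn1
    rw [real_inner_self_eq_norm_sq, real_inner_comm, hBsymm] at e1
    rw [real_inner_comm, real_inner_comm ψn1 φn, hBsymm] at e2
    rw [inner_sub_right, map_sub]
    linarith
  have hφ : 1 / Δt * ‖φn1 - φn‖ ^ 2 =
      -(ξ ^ 2 * (‖ψn1‖ ^ 2 - ⟪ψn1, ψn⟫) + 2 * sn1 * (sn1 - sn)) := by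
    rw [← real_inner_self_eq_norm_sq, hd, h3, ← hψ]
    field_simp
  rw [hφ, norm_sub_sq_real]
  ring
end

section
/- Suppose (φⁿ⁺¹,ψⁿ⁺¹,sⁿ⁺¹) is obtained from (φⁿ,ψⁿ,sⁿ) by one step of the fully discrete SAV scheme for the L² (Allen–Cahn) gradient flow. Then the scheme is unconditionally energy stable for the modified energy: Ẽ(ψⁿ⁺¹,sⁿ⁺¹) ≤ Ẽ(ψⁿ,sⁿ), for every time step Δt > 0. -/
open scoped RealInnerProductSpace

/-- One step of the fully discrete SAV scheme for the L² (Allen–Cahn) gradient flow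
is unconditionally energy stable for the modified energy, for every time step Δt > 0. -/
theorem sav_AC_energy_stable
    {V : Type*} [NormedAddCommGroup V] [InnerProductSpace ℝ V]
    (B : V →ₗ[ℝ] V →ₗ[ℝ] ℝ) (hBsymm : ∀ v w : V, B v w = B w v)
    (ξ : ℝ) (Δt : ℝ) (hΔt : 0 < Δt) (u : V)
    (φn φn1 ψn ψn1 : V) (sn sn1 : ℝ)
    (h1 : ∀ v : V, ⟪φn1 - φn, v⟫ =
      -(Δt * (ξ ^ 2 * ⟪ψn1, v⟫ - ξ ^ 2 * B ψn1 v + sn1 * ⟪u, v⟫)))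
    (h2 : ∀ v : V, ⟪ψn1, v⟫ = ⟪φn1, v⟫ - B φn1 v)
    (h2' : ∀ v : V, ⟪ψn, v⟫ = ⟪φn, v⟫ - B φn v)
    (h3 : sn1 - sn = (1 / 2) * ⟪u, φn1 - φn⟫) :
    ξ ^ 2 / 2 * ‖ψn1‖ ^ 2 + sn1 ^ 2 ≤ ξ ^ 2 / 2 * ‖ψn‖ ^ 2 + sn ^ 2 := by
  have h_diff : ⟪ψn1, φn1 - φn⟫ - B ψn1 (φn1 - φn) = ⟪ψn1, ψn1⟫ - ⟪ψn, ψn1⟫ := by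
    rw [h2 ψn1, h2' ψn1, hBsymm ψn1, real_inner_comm, map_sub, LinearMap.sub_apply,
      inner_sub_left]
    ring
  have h_dissip : ξ ^ 2 * (⟪ψn1, ψn1⟫ - ⟪ψn, ψn1⟫) + 2 * sn1 * (sn1 - sn) ≤ 0 := by
    rw [← h_diff, h3]
    refine nonpos_of_mul_nonpos_right ?_ hΔt
    linarith [h1 (φn1 - φn), real_inner_self_nonneg (x := φn1 - φn)]
  have h_norm : ‖ψn1 - ψn‖ ^ 2 = ‖ψn1‖ ^ 2 - 2 * ⟪ψn, ψn1⟫ + ‖ψn‖ ^ 2 := by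
    rw [norm_sub_sq_real, real_inner_comm]
  rw [real_inner_self_eq_norm_sq] at h_dissip
  have h_incr : 0 ≤ ξ ^ 2 * (‖ψn1‖ ^ 2 - 2 * ⟪ψn, ψn1⟫ + ‖ψn‖ ^ 2) := by
    rw [← h_norm]
    positivity
  linarith [sq_nonneg (sn1 - sn)]
end

section
/- Let (φₙ)ₙ, (ψₙ)ₙ be sequences in V and (sₙ)ₙ a real sequence such that for every n ∈ ℕ, (φₙ₊₁,ψₙ₊₁,sₙ₊₁) is obtained from (φₙ,ψₙ,sₙ) by one step of the fully discrete SAV scheme for the L² (Allen–Cahn) gradient flow (with data uₙ ∈ V at step n). Then for every N ∈ ℕ the telescoped energy identity holds: Ẽ(ψ_N,s_N) + Σ_{n=0}^{N−1} ( (1/Δt)‖φₙ₊₁−φₙ‖² + (ξ²/2)‖ψₙ₊₁−ψₙ‖² + (sₙ₊₁−sₙ)² ) = Ẽ(ψ₀,s₀). -/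
open scoped RealInnerProductSpace

/-- Telescoped modified-energy identity for the fully discrete SAV scheme for the
L² (Allen–Cahn) gradient flow. -/
theorem sav_AC_telescoped_energy
    {V : Type*} [NormedAddCommGroup V] [InnerProductSpace ℝ V]
    (B : V →ₗ[ℝ] V →ₗ[ℝ] ℝ) (hBsymm : ∀ v w : V, B v w = B w v)
    (ξ : ℝ) (Δt : ℝ) (hΔt : 0 < Δt) (u : ℕ → V)
    (φ ψ : ℕ → V) (s : ℕ → ℝ)
    (h1 : ∀ n : ℕ, ∀ v : V, ⟪φ (n + 1) - φ n, v⟫ =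
      -(Δt * (ξ ^ 2 * ⟪ψ (n + 1), v⟫ - ξ ^ 2 * B (ψ (n + 1)) v + s (n + 1) * ⟪u n, v⟫)))
    (h2 : ∀ n : ℕ, ∀ v : V, ⟪ψ n, v⟫ = ⟪φ n, v⟫ - B (φ n) v)
    (h3 : ∀ n : ℕ, s (n + 1) - s n = (1 / 2) * ⟪u n, φ (n + 1) - φ n⟫) :
    ∀ N : ℕ,
      (ξ ^ 2 / 2 * ‖ψ N‖ ^ 2 + s N ^ 2) +
        ∑ n ∈ Finset.range N,
          ((1 / Δt) * ‖φ (n + 1) - φ n‖ ^ 2 + ξ ^ 2 / 2 * ‖ψ (n + 1) - ψ n‖ ^ 2 +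
            (s (n + 1) - s n) ^ 2)
      = ξ ^ 2 / 2 * ‖ψ 0‖ ^ 2 + s 0 ^ 2 := by
  intro N
  induction N with
  | zero => simp
  | succ n ih =>
    have energy_step :
        (1 / Δt) * ‖φ (n + 1) - φ n‖ ^ 2 +
          ξ ^ 2 * ⟪ψ (n + 1) - ψ n, ψ (n + 1)⟫ + 2 * s (n + 1) * (s (n + 1) - s n) = 0 := by
      have hφ := h1 n (φ (n + 1) - φ n)
      have hψ : ⟪ψ (n + 1) - ψ n, ψ (n + 1)⟫ =
          ⟪ψ (n + 1), φ (n + 1) - φ n⟫ - B (ψ (n + 1)) (φ (n + 1) - φ n) := by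
        rw [inner_sub_left, h2 (n + 1) (ψ (n + 1)), h2 n (ψ (n + 1)), hBsymm (ψ (n + 1)),
          real_inner_comm (φ (n + 1) - φ n), inner_sub_left, map_sub, LinearMap.sub_apply]
        ring
      rw [real_inner_self_eq_norm_sq] at hφ
      rw [hφ, hψ, h3 n]
      field_simp
      ring
    have hnorm : ‖ψ (n + 1) - ψ n‖ ^ 2 =
        2 * ⟪ψ (n + 1) - ψ n, ψ (n + 1)⟫ - ‖ψ (n + 1)‖ ^ 2 + ‖ψ n‖ ^ 2 := by
      rw [norm_sub_sq_real, inner_sub_left, real_inner_self_eq_norm_sq,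
        real_inner_comm (ψ (n + 1)) (ψ n)]
      ring
    rw [Finset.sum_range_succ, hnorm]
    linear_combination ih + energy_step
end

section
/- Let (φₙ)ₙ, (ψₙ)ₙ be sequences in V and (sₙ)ₙ a real sequence such that for every n ∈ ℕ, (φₙ₊₁,ψₙ₊₁,sₙ₊₁) is obtained from (φₙ,ψₙ,sₙ) by one step of the fully discrete SAV scheme for the L² (Allen–Cahn) gradient flow (with data uₙ ∈ V at step n). If ξ ≠ 0, then the trajectory is uniformly bounded by the initial modified energy: for every n ∈ ℕ, ‖ψₙ‖² ≤ (2/ξ²)·Ẽ(ψ₀,s₀) and (sₙ)² ≤ Ẽ(ψ₀,s₀). -/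
open scoped RealInnerProductSpace

/-- One step of the scheme does not increase the modified energy. -/
theorem sav_AC_energy_step
    {V : Type*} [NormedAddCommGroup V] [InnerProductSpace ℝ V]
    (B : V →ₗ[ℝ] V →ₗ[ℝ] ℝ) (hBsymm : ∀ v w : V, B v w = B w v)
    {ξ Δt : ℝ} (hΔt : 0 < Δt) {u φ φ' ψ ψ' : V} {s s' : ℝ}
    (h1 : ∀ v : V, ⟪φ' - φ, v⟫ = -(Δt * (ξ ^ 2 * ⟪ψ', v⟫ - ξ ^ 2 * B ψ' v + s' * ⟪u, v⟫)))
    (h2 : ∀ v : V, ⟪ψ, v⟫ = ⟪φ, v⟫ - B φ v)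
    (h2' : ∀ v : V, ⟪ψ', v⟫ = ⟪φ', v⟫ - B φ' v)
    (h3 : s' - s = (1 / 2) * ⟪u, φ' - φ⟫) :
    ξ ^ 2 / 2 * ‖ψ'‖ ^ 2 + s' ^ 2 ≤ ξ ^ 2 / 2 * ‖ψ‖ ^ 2 + s ^ 2 := by
  have hψ : ⟪ψ', φ' - φ⟫ - B ψ' (φ' - φ) = ‖ψ'‖ ^ 2 - ⟪ψ, ψ'⟫ := by
    rw [← real_inner_self_eq_norm_sq, h2' ψ', h2 ψ', real_inner_comm, hBsymm, inner_sub_left,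
      map_sub, LinearMap.sub_apply]
    ring
  have hd : 0 ≤ -(Δt * (ξ ^ 2 * (‖ψ'‖ ^ 2 - ⟪ψ, ψ'⟫) + 2 * s' * (s' - s))) := by
    have h : -(Δt * (ξ ^ 2 * (‖ψ'‖ ^ 2 - ⟪ψ, ψ'⟫) + 2 * s' * (s' - s))) =
        ⟪φ' - φ, φ' - φ⟫ := by
      rw [h1, ← hψ, h3]
      ring
    rw [h]
    exact real_inner_self_nonneg
  have hle : ξ ^ 2 * (‖ψ'‖ ^ 2 - ⟪ψ, ψ'⟫) + 2 * s' * (s' - s) ≤ 0 := by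
    by_contra! h
    linarith [mul_pos hΔt h]
  have hsq : 0 ≤ ξ ^ 2 * (‖ψ‖ ^ 2 - 2 * ⟪ψ, ψ'⟫ + ‖ψ'‖ ^ 2) := by
    rw [← norm_sub_sq_real]
    positivity
  linarith [sq_nonneg (s' - s)]

/-- The SAV trajectory for the L² (Allen–Cahn) gradient flow is uniformly bounded by
the initial modified energy. -/
theorem sav_AC_uniform_bound
    {V : Type*} [NormedAddCommGroup V] [InnerProductSpace ℝ V]
    (B : V →ₗ[ℝ] V →ₗ[ℝ] ℝ) (hBsymm : ∀ v w : V, B v w = B w v)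
    (ξ : ℝ) (hξ : ξ ≠ 0) (Δt : ℝ) (hΔt : 0 < Δt) (u : ℕ → V)
    (φ ψ : ℕ → V) (s : ℕ → ℝ)
    (h1 : ∀ n : ℕ, ∀ v : V, ⟪φ (n + 1) - φ n, v⟫ =
      -(Δt * (ξ ^ 2 * ⟪ψ (n + 1), v⟫ - ξ ^ 2 * B (ψ (n + 1)) v + s (n + 1) * ⟪u n, v⟫)))
    (h2 : ∀ n : ℕ, ∀ v : V, ⟪ψ n, v⟫ = ⟪φ n, v⟫ - B (φ n) v)
    (h3 : ∀ n : ℕ, s (n + 1) - s n = (1 / 2) * ⟪u n, φ (n + 1) - φ n⟫) :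
    ∀ n : ℕ,
      ‖ψ n‖ ^ 2 ≤ (2 / ξ ^ 2) * (ξ ^ 2 / 2 * ‖ψ 0‖ ^ 2 + s 0 ^ 2) ∧
      s n ^ 2 ≤ ξ ^ 2 / 2 * ‖ψ 0‖ ^ 2 + s 0 ^ 2 := by
  have hE : ∀ n, ξ ^ 2 / 2 * ‖ψ n‖ ^ 2 + s n ^ 2 ≤ ξ ^ 2 / 2 * ‖ψ 0‖ ^ 2 + s 0 ^ 2 := by
    intro n
    induction n with
    | zero => exact le_rfl
    | succ n ih =>
      exact (sav_AC_energy_step B hBsymm hΔt (h1 n) (h2 n) (h2 (n + 1)) (h3 n)).trans ih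
  intro n
  have hs : 0 ≤ s n ^ 2 := sq_nonneg _
  have hψ : 0 ≤ ξ ^ 2 / 2 * ‖ψ n‖ ^ 2 := by positivity
  refine ⟨?_, by linarith [hE n]⟩
  calc ‖ψ n‖ ^ 2 = (2 / ξ ^ 2) * (ξ ^ 2 / 2 * ‖ψ n‖ ^ 2) := by field_simp
    _ ≤ _ := by
      gcongr
      linarith [hE n]
end

section
/- Suppose additionally that B is positive semidefinite (B(v,v) ≥ 0 for all v ∈ V), and that (φⁿ⁺¹,ψⁿ⁺¹,φ̃ⁿ⁺¹,sⁿ⁺¹) is obtained from (φⁿ,ψⁿ,sⁿ) by one step of the fully discrete SAV scheme for the H⁻¹ (Cahn–Hilliard) gradient flow. Then Ẽ(ψⁿ⁺¹,sⁿ⁺¹) − Ẽ(ψⁿ,sⁿ) = −( Δt·B(φ̃ⁿ⁺¹,φ̃ⁿ⁺¹) + (ξ²/2)‖ψⁿ⁺¹−ψⁿ‖² + (sⁿ⁺¹−sⁿ)² ); in particular Ẽ(ψⁿ⁺¹,sⁿ⁺¹) ≤ Ẽ(ψⁿ,sⁿ) unconditionally in Δt > 0. -/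
open scoped RealInnerProductSpace

/-- Per-step modified-energy dissipation identity, and unconditional energy stability,
for the fully discrete SAV scheme for the H⁻¹ (Cahn–Hilliard) gradient flow. -/
theorem sav_CH_energy_identity
    {V : Type*} [NormedAddCommGroup V] [InnerProductSpace ℝ V]
    (B : V →ₗ[ℝ] V →ₗ[ℝ] ℝ) (hBsymm : ∀ v w : V, B v w = B w v)
    (hBpos : ∀ v : V, 0 ≤ B v v)
    (ξ : ℝ) (Δt : ℝ) (hΔt : 0 < Δt) (u : V)
    (φn φn1 ψn ψn1 φtilde : V) (sn sn1 : ℝ)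
    (h1 : ∀ v : V, ⟪φn1 - φn, v⟫ = -(Δt * B φtilde v))
    (h2 : ∀ v : V, ⟪φtilde, v⟫ =
      ξ ^ 2 * ⟪ψn1, v⟫ - ξ ^ 2 * B ψn1 v + sn1 * ⟪u, v⟫)
    (h3 : ∀ v : V, ⟪ψn1, v⟫ = ⟪φn1, v⟫ - B φn1 v)
    (h3' : ∀ v : V, ⟪ψn, v⟫ = ⟪φn, v⟫ - B φn v)
    (h4 : sn1 - sn = (1 / 2) * ⟪u, φn1 - φn⟫) :
    (ξ ^ 2 / 2 * ‖ψn1‖ ^ 2 + sn1 ^ 2) - (ξ ^ 2 / 2 * ‖ψn‖ ^ 2 + sn ^ 2) =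
      -(Δt * B φtilde φtilde + ξ ^ 2 / 2 * ‖ψn1 - ψn‖ ^ 2 + (sn1 - sn) ^ 2) ∧
    ξ ^ 2 / 2 * ‖ψn1‖ ^ 2 + sn1 ^ 2 ≤ ξ ^ 2 / 2 * ‖ψn‖ ^ 2 + sn ^ 2 := by
  have hψ : ⟪ψn1, ψn1⟫ - ⟪ψn, ψn1⟫ = ⟪ψn1, φn1 - φn⟫ - B ψn1 (φn1 - φn) := by
    rw [h3 ψn1, h3' ψn1, hBsymm φn1, hBsymm φn, inner_sub_right, map_sub,
      real_inner_comm ψn1 φn1, real_inner_comm ψn1 φn]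
    ring
  have hdiss : -(Δt * B φtilde φtilde) =
      ξ ^ 2 * (⟪ψn1, ψn1⟫ - ⟪ψn, ψn1⟫) + 2 * sn1 * (sn1 - sn) := by
    rw [← h1 φtilde, real_inner_comm, h2, hψ, h4]
    ring
  have hnorm := norm_sub_sq_real ψn1 ψn
  rw [real_inner_comm] at hnorm
  rw [real_inner_self_eq_norm_sq] at hdiss
  have hident : (ξ ^ 2 / 2 * ‖ψn1‖ ^ 2 + sn1 ^ 2) - (ξ ^ 2 / 2 * ‖ψn‖ ^ 2 + sn ^ 2) =
      -(Δt * B φtilde φtilde + ξ ^ 2 / 2 * ‖ψn1 - ψn‖ ^ 2 + (sn1 - sn) ^ 2) := by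
    rw [hnorm]
    linear_combination -hdiss
  have hnonneg : 0 ≤ Δt * B φtilde φtilde := mul_nonneg hΔt.le (hBpos φtilde)
  have hpos : 0 ≤ ξ ^ 2 / 2 * ‖ψn1 - ψn‖ ^ 2 + (sn1 - sn) ^ 2 := by positivity
  exact ⟨hident, by linarith⟩
end

section
/- Let E be a real inner product space which is complete, let a < b be real numbers, and let f : ℝ → E be such that f is differentiable with derivative f′ on [a,b], f′ is differentiable with derivative f″ on [a,b], and f″ is continuous on [a,b]. Then ‖f(b) − f(a) − (b−a)·f′(b)‖² ≤ ((b−a)³/3)·∫ₐᵇ ‖f″(r)‖² dr. -/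
/-- Cauchy–Schwarz inequality for continuous real functions on a compact interval. -/
theorem sq_intervalIntegral_mul_le {a b : ℝ} (hab : a ≤ b) {u v : ℝ → ℝ}
    (hu : ContinuousOn u (Set.Icc a b)) (hv : ContinuousOn v (Set.Icc a b)) :
    (∫ t in a..b, u t * v t) ^ 2 ≤ (∫ t in a..b, u t ^ 2) * ∫ t in a..b, v t ^ 2 := by
  have huv : IntervalIntegrable (fun t => u t * v t) MeasureTheory.volume a b :=
    (hu.mul hv).intervalIntegrable_of_Icc hab
  have huu : IntervalIntegrable (fun t => u t ^ 2) MeasureTheory.volume a b :=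
    (hu.pow 2).intervalIntegrable_of_Icc hab
  have hvv : IntervalIntegrable (fun t => v t ^ 2) MeasureTheory.volume a b :=
    (hv.pow 2).intervalIntegrable_of_Icc hab
  have key : ∀ c : ℝ, 0 ≤ (∫ t in a..b, u t ^ 2) * (c * c) +
      (-2 * ∫ t in a..b, u t * v t) * c + ∫ t in a..b, v t ^ 2 := by
    intro c
    have h : 0 ≤ ∫ t in a..b, (c * u t - v t) ^ 2 :=
      intervalIntegral.integral_nonneg hab fun t _ => sq_nonneg _
    have hexp : (fun t => (c * u t - v t) ^ 2) =
        fun t => c ^ 2 * u t ^ 2 - 2 * c * (u t * v t) + v t ^ 2 := by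
      funext t; ring
    rw [hexp, intervalIntegral.integral_add
        ((huu.const_mul (c ^ 2)).sub (huv.const_mul (2 * c))) hvv,
      intervalIntegral.integral_sub (huu.const_mul (c ^ 2)) (huv.const_mul (2 * c)),
      intervalIntegral.integral_const_mul, intervalIntegral.integral_const_mul] at h
    linarith
  have hd := discrim_le_zero key
  rw [discrim] at hd
  linarith

/-- First-order Taylor remainder, expanded at the right endpoint, in integral form. -/
theorem integral_sub_smul_deriv_two_eq
    {E : Type*} [NormedAddCommGroup E] [NormedSpace ℝ E] [CompleteSpace E]
    {a b : ℝ} (hab : a ≤ b) {f f' f'' : ℝ → E}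
    (hf : ∀ t ∈ Set.Icc a b, HasDerivWithinAt f (f' t) (Set.Icc a b) t)
    (hf' : ∀ t ∈ Set.Icc a b, HasDerivWithinAt f' (f'' t) (Set.Icc a b) t)
    (hf'' : ContinuousOn f'' (Set.Icc a b)) :
    ∫ t in a..b, (t - a) • f'' t = -(f b - f a - (b - a) • f' b) := by
  have hderiv : ∀ t ∈ Set.Icc a b,
      HasDerivWithinAt (fun s => (s - a) • f' s - f s) ((t - a) • f'' t) (Set.Icc a b) t := by
    intro t ht
    have h := (((hasDerivWithinAt_id t (Set.Icc a b)).sub_const a).smul (hf' t ht)).sub (hf t ht)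
    refine h.congr_deriv ?_
    simp
  have hcont : ContinuousOn (fun t => (t - a) • f'' t) (Set.Icc a b) :=
    ContinuousOn.smul (by fun_prop) hf''
  rw [intervalIntegral.integral_eq_sub_of_hasDerivAt_of_le hab
    (fun t ht => (hderiv t ht).continuousWithinAt)
    (fun t ht => (hderiv t (Set.Ioo_subset_Icc_self ht)).hasDerivAt (Icc_mem_nhds ht.1 ht.2))
    (hcont.intervalIntegrable_of_Icc hab)]
  simp only [sub_self, zero_smul]
  abel

/-- Backward-Euler Taylor remainder bound used to obtain first-order accuracy in time
in the error analysis of the SAV scheme. -/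
theorem backward_euler_taylor_remainder
    {E : Type*} [NormedAddCommGroup E] [InnerProductSpace ℝ E] [CompleteSpace E]
    (a b : ℝ) (hab : a < b) (f f' f'' : ℝ → E)
    (hf : ∀ t ∈ Set.Icc a b, HasDerivWithinAt f (f' t) (Set.Icc a b) t)
    (hf' : ∀ t ∈ Set.Icc a b, HasDerivWithinAt f' (f'' t) (Set.Icc a b) t)
    (hf'' : ContinuousOn f'' (Set.Icc a b)) :
    ‖f b - f a - (b - a) • f' b‖ ^ 2 ≤
      ((b - a) ^ 3 / 3) * ∫ r in a..b, ‖f'' r‖ ^ 2 := by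
  have hR : ‖f b - f a - (b - a) • f' b‖ ≤ ∫ t in a..b, (t - a) * ‖f'' t‖ := by
    rw [← norm_neg, ← integral_sub_smul_deriv_two_eq hab.le hf hf' hf'']
    refine (intervalIntegral.norm_integral_le_integral_norm hab.le).trans_eq ?_
    refine intervalIntegral.integral_congr fun t ht => ?_
    rw [Set.uIcc_of_le hab.le] at ht
    simp only [norm_smul, Real.norm_of_nonneg (sub_nonneg.2 ht.1)]
  have hK : ∫ t in a..b, (t - a) ^ 2 = (b - a) ^ 3 / 3 := by
    rw [intervalIntegral.integral_comp_sub_right (fun t => t ^ 2) a, integral_pow]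
    norm_num
  calc ‖f b - f a - (b - a) • f' b‖ ^ 2
      ≤ (∫ t in a..b, (t - a) * ‖f'' t‖) ^ 2 := by gcongr
    _ ≤ (∫ t in a..b, (t - a) ^ 2) * ∫ t in a..b, ‖f'' t‖ ^ 2 :=
        sq_intervalIntegral_mul_le hab.le (by fun_prop) hf''.norm
    _ = (b - a) ^ 3 / 3 * ∫ r in a..b, ‖f'' r‖ ^ 2 := by rw [hK]
end
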